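/- Let ρ : (a,b) → (n×n complex matrices) be a continuously differentiable curve such that ρ(t) is Hermitian positive definite for every t. Then the function t ↦ tr(ρ(t)·log ρ(t)) is differentiable, with derivative tr(ρ'(t)·(log ρ(t) + I)) for every t ∈ (a,b); in particular, if tr ρ(t) is constant in t, the derivative equals tr(ρ'(t)·log ρ(t)). -/

import Mathlib

open Matrix
open scoped ComplexOrder

attribute [local instance] Matrix.normedAddCommGroup Matrix.normedSpace

/-- Functional calculus for Hermitian matrices: apply `f : ℝ → ℝ` to the eigenvalues in a
spectral decomposition `A = U diag(λᵢ) U*` (junk value `0` if `A` is not Hermitian). -/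
noncomputable def hermCFC {n : ℕ} (f : ℝ → ℝ) (A : Matrix (Fin n) (Fin n) ℂ) :
    Matrix (Fin n) (Fin n) ℂ :=
  if hA : A.IsHermitian then
    (hA.eigenvectorUnitary : Matrix (Fin n) (Fin n) ℂ) *
      Matrix.diagonal (fun i => (f (hA.eigenvalues i) : ℂ)) *
      star (hA.eigenvectorUnitary : Matrix (Fin n) (Fin n) ℂ)
  else 0

theorem hermCFC_of_isHermitian {n : ℕ} {A : Matrix (Fin n) (Fin n) ℂ} (hA : A.IsHermitian)
    (f : ℝ → ℝ) :
    hermCFC f A = (hA.eigenvectorUnitary : Matrix (Fin n) (Fin n) ℂ) *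
      diagonal (fun i => (f (hA.eigenvalues i) : ℂ)) *
      star (hA.eigenvectorUnitary : Matrix (Fin n) (Fin n) ℂ) :=
  dif_pos hA

theorem hermCFC_mul {n : ℕ} {A : Matrix (Fin n) (Fin n) ℂ} (hA : A.IsHermitian)
    (f g : ℝ → ℝ) : hermCFC f A * hermCFC g A = hermCFC (fun x => f x * g x) A := by
  have hU : star (hA.eigenvectorUnitary : Matrix (Fin n) (Fin n) ℂ) * hA.eigenvectorUnitary = 1 :=
    Unitary.coe_star_mul_self _
  simp only [hermCFC_of_isHermitian hA]
  generalize (hA.eigenvectorUnitary : Matrix (Fin n) (Fin n) ℂ) = U at hU ⊢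
  have h (D E : Matrix (Fin n) (Fin n) ℂ) :
      U * D * star U * (U * E * star U) = U * (D * E) * star U := by
    calc _ = U * D * (star U * U) * E * star U := by simp only [Matrix.mul_assoc]
      _ = _ := by rw [hU, Matrix.mul_one, Matrix.mul_assoc U]
  simp only [h, diagonal_mul_diagonal, Complex.ofReal_mul]

theorem hermCFC_eq_one {n : ℕ} {A : Matrix (Fin n) (Fin n) ℂ} (hA : A.IsHermitian)
    {f : ℝ → ℝ} (hf : ∀ i, f (hA.eigenvalues i) = 1) : hermCFC f A = 1 := by
  rw [hermCFC_of_isHermitian hA]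
  simp only [hf, Complex.ofReal_one, diagonal_one, Matrix.mul_one]
  exact Unitary.coe_mul_star_self _

theorem hermCFC_id {n : ℕ} {A : Matrix (Fin n) (Fin n) ℂ} (hA : A.IsHermitian) :
    hermCFC (fun x => x) A = A := by
  rw [hermCFC_of_isHermitian hA]
  conv_rhs => rw [hA.spectral_theorem]
  rfl

/-- The trace pairing of two functional calculi is a double sum over the eigenvalues, with
nonnegative weights (the squared overlaps of the eigenvectors). -/
theorem exists_trace_hermCFC_mul {n : ℕ} {A B : Matrix (Fin n) (Fin n) ℂ}
    (hA : A.IsHermitian) (hB : B.IsHermitian) :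
    ∃ w : Fin n → Fin n → ℝ, (∀ i j, 0 ≤ w i j) ∧ ∀ f g : ℝ → ℝ,
      (hermCFC f A * hermCFC g B).trace =
        ((∑ i, ∑ j, w i j * (f (hA.eigenvalues i) * g (hB.eigenvalues j)) : ℝ) : ℂ) := by
  refine ⟨fun i j => Complex.normSq ((star (hA.eigenvectorUnitary : Matrix (Fin n) (Fin n) ℂ) *
    hB.eigenvectorUnitary) i j), fun i j => Complex.normSq_nonneg _, fun f g => ?_⟩
  rw [hermCFC_of_isHermitian hA, hermCFC_of_isHermitian hB]
  generalize (hA.eigenvectorUnitary : Matrix (Fin n) (Fin n) ℂ) = U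
  generalize (hB.eigenvectorUnitary : Matrix (Fin n) (Fin n) ℂ) = V
  set D := diagonal (fun i => (f (hA.eigenvalues i) : ℂ)) with hD
  set E := diagonal (fun i => (g (hB.eigenvalues i) : ℂ)) with hE
  have key : (U * D * star U * (V * E * star V)).trace =
      (D * (star U * V) * E * star (star U * V)).trace := by
    rw [star_mul, star_star, Matrix.mul_assoc U, Matrix.mul_assoc U, trace_mul_comm U]
    simp only [Matrix.mul_assoc]
  rw [key, trace]
  push_cast
  refine Finset.sum_congr rfl fun i _ => ?_
  rw [diag_apply, mul_apply]
  refine Finset.sum_congr rfl fun j _ => ?_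
  rw [hE, mul_diagonal, hD, diagonal_mul, star_apply, ← Complex.mul_conj, starRingEnd_apply]
  ring

theorem mul_log_sub_nonneg {a b : ℝ} (ha : 0 < a) (hb : 0 < b) :
    0 ≤ a * Real.log a - a * Real.log b - a + b := by
  have h := Real.log_le_sub_one_of_pos (div_pos hb ha)
  rw [Real.log_div hb.ne' ha.ne'] at h
  have h2 := mul_le_mul_of_nonneg_left h ha.le
  have h3 : a * (b / a - 1) = b - a := by field_simp
  linarith

theorem mul_log_sub_le {a b : ℝ} (ha : 0 < a) (hb : 0 < b) :
    a * Real.log a - a * Real.log b - a + b ≤ a * a * b⁻¹ - 2 * a + b := by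
  have h := Real.log_le_sub_one_of_pos (div_pos ha hb)
  rw [Real.log_div ha.ne' hb.ne'] at h
  have h2 := mul_le_mul_of_nonneg_left h ha.le
  have h3 : a * (a / b - 1) = a * a * b⁻¹ - a := by ring
  linarith

/-- Klein's inequality together with its quadratic upper bound: the Bregman divergence of
`A ↦ tr (A log A)` is bounded by `tr ((A - B)² B⁻¹)`. -/
theorem norm_trace_mul_log_sub_le {n : ℕ} {A B : Matrix (Fin n) (Fin n) ℂ}
    (hA : A.PosDef) (hB : B.PosDef) :
    ‖(A * hermCFC Real.log A).trace - (B * hermCFC Real.log B).trace -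
        ((A - B) * (hermCFC Real.log B + 1)).trace‖ ≤
      ‖((A - B) * (A - B) * hermCFC (fun x => x⁻¹) B).trace‖ := by
  obtain ⟨w, hw, hwt⟩ := exists_trace_hermCFC_mul hA.1 hB.1
  have hA1 := hermCFC_eq_one hA.1 (f := fun _ => 1) fun _ => rfl
  have hB1 := hermCFC_eq_one hB.1 (f := fun _ => 1) fun _ => rfl
  have hBinv : B * hermCFC (fun x => x⁻¹) B = 1 := by
    conv_lhs => enter [1]; rw [← hermCFC_id hB.1]
    rw [hermCFC_mul hB.1]
    exact hermCFC_eq_one hB.1 fun i => mul_inv_cancel₀ (hB.eigenvalues_pos i).ne'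
  have hBinv' : hermCFC (fun x => x⁻¹) B * B = 1 := mul_eq_one_comm.mp hBinv
  have hAlog : A * hermCFC Real.log A = hermCFC (fun x => x * Real.log x) A := by
    rw [← hermCFC_mul hA.1 (fun x => x), hermCFC_id hA.1]
  have hAA : A * A = hermCFC (fun x => x * x) A := by
    rw [← hermCFC_mul hA.1 (fun x => x) (fun x => x), hermCFC_id hA.1]
  have e₁ := hwt (fun x => x * Real.log x) (fun _ => 1)
  have e₂ := hwt (fun x => x) Real.log
  have e₃ := hwt (fun x => x) (fun _ => 1)
  have e₄ := hwt (fun _ => 1) (fun x => x)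
  have e₅ := hwt (fun x => x * x) (fun x => x⁻¹)
  rw [hB1, Matrix.mul_one, ← hAlog] at e₁
  rw [hermCFC_id hA.1] at e₂
  rw [hermCFC_id hA.1, hB1, Matrix.mul_one] at e₃
  rw [hA1, Matrix.one_mul, hermCFC_id hB.1] at e₄
  rw [← hAA] at e₅
  have hl : (A * hermCFC Real.log A).trace - (B * hermCFC Real.log B).trace -
        ((A - B) * (hermCFC Real.log B + 1)).trace =
      ((∑ i, ∑ j, w i j * (hA.1.eigenvalues i * Real.log (hA.1.eigenvalues i) -
        hA.1.eigenvalues i * Real.log (hB.1.eigenvalues j) - hA.1.eigenvalues i +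
        hB.1.eigenvalues j) : ℝ) : ℂ) := by
    simp only [Matrix.sub_mul, Matrix.mul_add, Matrix.mul_one, trace_sub, trace_add]
    rw [e₁, e₂, e₃, e₄]
    simp only [mul_add, mul_sub, Finset.sum_add_distrib, Finset.sum_sub_distrib, mul_one, one_mul]
    push_cast
    ring
  have hr : ((A - B) * (A - B) * hermCFC (fun x => x⁻¹) B).trace =
      ((∑ i, ∑ j, w i j * (hA.1.eigenvalues i * hA.1.eigenvalues i * (hB.1.eigenvalues j)⁻¹ -
        2 * hA.1.eigenvalues i + hB.1.eigenvalues j) : ℝ) : ℂ) := by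
    have hBA : (B * A * hermCFC (fun x => x⁻¹) B).trace = A.trace := by
      rw [trace_mul_comm, ← Matrix.mul_assoc, hBinv', Matrix.one_mul]
    simp only [Matrix.sub_mul, Matrix.mul_sub, trace_sub, hBA]
    rw [Matrix.mul_assoc A B, Matrix.mul_assoc B B, hBinv, Matrix.mul_one, Matrix.mul_one,
      e₃, e₄, e₅]
    simp only [mul_add, mul_sub, Finset.sum_add_distrib, Finset.sum_sub_distrib, mul_one, one_mul,
      two_mul]
    push_cast
    ring
  rw [hl, hr, Complex.norm_real, Complex.norm_real]
  have h₀ := fun i j => mul_log_sub_nonneg (hA.eigenvalues_pos i) (hB.eigenvalues_pos j)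
  have h₁ := fun i j => mul_log_sub_le (hA.eigenvalues_pos i) (hB.eigenvalues_pos j)
  rw [Real.norm_of_nonneg (Finset.sum_nonneg fun i _ => Finset.sum_nonneg fun j _ =>
    mul_nonneg (hw i j) (h₀ i j))]
  exact (Finset.sum_le_sum fun i _ => Finset.sum_le_sum fun j _ =>
    mul_le_mul_of_nonneg_left (h₁ i j) (hw i j)).trans (Real.le_norm_self _)

theorem hasDerivAt_trace_mul_const {n : ℕ} {ρ : ℝ → Matrix (Fin n) (Fin n) ℂ}
    {ρ' : Matrix (Fin n) (Fin n) ℂ} {t : ℝ} (h : HasDerivAt ρ ρ' t)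
    (M : Matrix (Fin n) (Fin n) ℂ) :
    HasDerivAt (fun s => (ρ s * M).trace) (ρ' * M).trace t := by
  simp only [trace, diag_apply, mul_apply]
  exact HasDerivAt.fun_sum fun i _ => HasDerivAt.fun_sum fun j _ =>
    (hasDerivAt_pi.mp (hasDerivAt_pi.mp h i) j).mul_const _

theorem isLittleO_trace_sub_mul_sub_mul {n : ℕ} {ρ : ℝ → Matrix (Fin n) (Fin n) ℂ}
    {ρ' : Matrix (Fin n) (Fin n) ℂ} {t : ℝ} (h : HasDerivAt ρ ρ' t)
    (M : Matrix (Fin n) (Fin n) ℂ) :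
    (fun s => ((ρ s - ρ t) * (ρ s - ρ t) * M).trace) =o[nhds t] fun s => s - t := by
  have hO : ∀ i j, (fun s => (ρ s - ρ t) i j) =O[nhds t] fun s => s - t := fun i j =>
    (hasDerivAt_pi.mp (hasDerivAt_pi.mp h i) j).differentiableAt.isBigO_sub
  have ho : (fun s : ℝ => s - t) =o[nhds t] fun _ => (1 : ℝ) := by
    rw [Asymptotics.isLittleO_one_iff]
    simpa using (continuous_sub_right t).tendsto t
  simp only [trace, diag_apply, mul_apply, Finset.sum_mul]
  refine .fun_sum fun i _ => .fun_sum fun k _ => .fun_sum fun j _ => ?_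
  have hij := (hO i j).mul_isLittleO ((hO j k).trans_isLittleO ho)
  simp only [mul_one] at hij
  simpa only [mul_comm _ (M k i)] using hij.const_mul_left (M k i)

theorem hasDerivAt_trace_mul_log_of_eventually_posDef {n : ℕ}
    {ρ : ℝ → Matrix (Fin n) (Fin n) ℂ} {ρ' : Matrix (Fin n) (Fin n) ℂ} {t : ℝ}
    (hpos : ∀ᶠ s in nhds t, (ρ s).PosDef) (h : HasDerivAt ρ ρ' t) :
    HasDerivAt (fun s => (ρ s * hermCFC Real.log (ρ s)).trace)
      (ρ' * (hermCFC Real.log (ρ t) + 1)).trace t := by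
  have hlin := hasDerivAt_trace_mul_const h (hermCFC Real.log (ρ t) + 1)
  rw [hasDerivAt_iff_isLittleO] at hlin ⊢
  have hrem : (fun s => (ρ s * hermCFC Real.log (ρ s)).trace -
      (ρ t * hermCFC Real.log (ρ t)).trace -
        ((ρ s - ρ t) * (hermCFC Real.log (ρ t) + 1)).trace) =o[nhds t] fun s => s - t :=
    (Asymptotics.IsBigO.of_bound' <| hpos.mono fun s hs =>
      norm_trace_mul_log_sub_le hs hpos.self_of_nhds).trans_isLittleO
      (isLittleO_trace_sub_mul_sub_mul h _)
  refine (hrem.add hlin).congr_left fun s => ?_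
  rw [Matrix.sub_mul, trace_sub]
  ring

/-- Along a continuously differentiable curve `ρ : (a,b) → {Hermitian positive definite
matrices}`, the function `t ↦ tr(ρ(t)·log ρ(t))` has derivative `tr(ρ'(t)·(log ρ(t) + I))`;
in particular, if `tr ρ(t)` is constant, the derivative equals `tr(ρ'(t)·log ρ(t))`. -/
theorem hasDerivAt_trace_mul_log
    {n : ℕ} (a b : ℝ) (ρ ρ' : ℝ → Matrix (Fin n) (Fin n) ℂ)
    (hpos : ∀ t ∈ Set.Ioo a b, (ρ t).PosDef)
    (hderiv : ∀ t ∈ Set.Ioo a b, HasDerivAt ρ (ρ' t) t)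
    (hcont : ContinuousOn ρ' (Set.Ioo a b)) :
    (∀ t ∈ Set.Ioo a b,
      HasDerivAt (fun s => ((ρ s) * hermCFC Real.log (ρ s)).trace)
        ((ρ' t * (hermCFC Real.log (ρ t) + 1)).trace) t) ∧
    ((∀ s ∈ Set.Ioo a b, ∀ t ∈ Set.Ioo a b, (ρ s).trace = (ρ t).trace) →
      ∀ t ∈ Set.Ioo a b,
        HasDerivAt (fun s => ((ρ s) * hermCFC Real.log (ρ s)).trace)
          ((ρ' t * hermCFC Real.log (ρ t)).trace) t) := by
  have hmain : ∀ t ∈ Set.Ioo a b,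
      HasDerivAt (fun s => ((ρ s) * hermCFC Real.log (ρ s)).trace)
        ((ρ' t * (hermCFC Real.log (ρ t) + 1)).trace) t := fun t ht =>
    hasDerivAt_trace_mul_log_of_eventually_posDef
      (Filter.mem_of_superset (isOpen_Ioo.mem_nhds ht) hpos) (hderiv t ht)
  refine ⟨hmain, fun hconst t ht => ?_⟩
  have htr : HasDerivAt (fun s => (ρ s).trace) (ρ' t).trace t := by
    simpa only [Matrix.mul_one] using hasDerivAt_trace_mul_const (hderiv t ht) 1
  have hzero : (ρ' t).trace = 0 :=
    htr.unique <| (hasDerivAt_const t (ρ t).trace).congr_of_eventuallyEq <|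
      Filter.mem_of_superset (isOpen_Ioo.mem_nhds ht) fun s hs => hconst s hs t ht
  simpa only [Matrix.mul_add, Matrix.mul_one, trace_add, hzero, add_zero] using hmain t ht
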